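/- Let n ≥ 1 and let m be a nonnegative integer. Then, as an identity of rational functions in ℚ(x_1,…,x_n), the Schur polynomial s_{(m^n)} in the 2n+1 variables (x_1, x_1^{−1}, …, x_n, x_n^{−1}, 1) equals the sum of the symplectic characters sp_λ(x_1,…,x_n) over all partitions λ ∈ Par((m^n)). -/

import Mathlib

open Matrix BigOperators
open scoped Classical

noncomputable section

/-- The field `ℚ(t_1, …, t_n)` of rational functions in `n` indeterminates over `ℚ`. -/
abbrev FF (n : ℕ) : Type := FractionRing (MvPolynomial (Fin n) ℚ)

/-- The `i`-th indeterminate, viewed as an element of `FF n`. -/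
def gen (n : ℕ) (i : Fin n) : FF n :=
  algebraMap (MvPolynomial (Fin n) ℚ) (FF n) (MvPolynomial.X i)

variable {F : Type*} [Field F]

/-- Symplectic character `sp_λ(z_1, …, z_N)` for an integer weight `μ`. -/
def spP {N : ℕ} (z : Fin N → F) (μ : Fin N → ℤ) : F :=
  Matrix.det (Matrix.of fun i j : Fin N =>
      z j ^ (μ i + (N : ℤ) - (i : ℕ)) - z j ^ (-(μ i + (N : ℤ) - (i : ℕ)))) /
  Matrix.det (Matrix.of fun i j : Fin N =>
      z j ^ ((N : ℤ) - (i : ℕ)) - z j ^ (-((N : ℤ) - (i : ℕ))))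

/-- The matrix `Ā_λ` of the bialternant formula for the intermediate symplectic character
`sp^{(k, N-k)}` with integer weight `μ`. -/
def interMatP {N : ℕ} (k : ℕ) (z : Fin N → F) (μ : Fin N → ℤ) : Matrix (Fin N) (Fin N) F :=
  Matrix.of fun i j : Fin N =>
    if (j : ℕ) < k then
      z j ^ (μ i + (k : ℤ) - (i : ℕ)) /
          ∏ l ∈ Finset.univ.filter (fun l : Fin N => k ≤ (l : ℕ)), (1 - (z j)⁻¹ * z l) -
        z j ^ (-(μ i + (k : ℤ) - (i : ℕ))) /
          ∏ l ∈ Finset.univ.filter (fun l : Fin N => k ≤ (l : ℕ)), (1 - z j * z l)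
    else z j ^ (μ i + (N : ℤ) - 1 - (i : ℕ))

/-- Intermediate symplectic character `sp^{(k, N-k)}_μ(z_1, …, z_k | z_{k+1}, …, z_N)`
for an integer weight `μ`. -/
def spInterP {N : ℕ} (k : ℕ) (z : Fin N → F) (μ : Fin N → ℤ) : F :=
  (interMatP k z μ).det / (interMatP k z fun _ => 0).det

/-- Schur function `s_μ(z_1, …, z_N)` as a ratio of alternants (bialternant formula). -/
def schurP {N : ℕ} (z : Fin N → F) (μ : Fin N → ℤ) : F :=
  Matrix.det (Matrix.of fun i j : Fin N => z j ^ (μ i + (N : ℤ) - 1 - (i : ℕ))) /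
  Matrix.det (Matrix.of fun i j : Fin N => z j ^ ((N : ℤ) - 1 - (i : ℕ)))

theorem det_add_eq_sum {n : ℕ} (M : Bool → Matrix (Fin n) (Fin n) F) :
    (Matrix.of fun i j => M true i j + M false i j).det =
      ∑ ε : Fin n → Bool, (Matrix.of fun i j => M (ε j) i j).det := by
  have h := (Matrix.detRowAlternating (R := F) (n := Fin n)).toMultilinearMap.map_sum
    (g := fun j (b : Bool) => (fun i => M b i j))
  rw [← Matrix.det_transpose]
  refine Eq.trans ?_ (h.trans ?_)
  · refine congrArg Matrix.det ?_
    ext j i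
    simp [Matrix.transpose_apply, Finset.sum_apply]
  · refine Finset.sum_congr rfl fun ε _ => ?_
    exact Matrix.det_transpose (Matrix.of fun i j => M (ε j) i j)

/-- The alternant `det (z_j ^ (n - 1 - i))`. -/
def alternant {n : ℕ} (z : Fin n → F) : F :=
  Matrix.det (Matrix.of fun i j : Fin n => z j ^ (i.rev : ℕ))

theorem alternant_eq_prod {n : ℕ} (z : Fin n → F) :
    alternant z = ∏ i, ∏ j ∈ Finset.Ioi i, (z i - z j) := by
  have h := Matrix.det_projVandermonde (R := F) (n := n) 1 z
  rw [alternant, ← Matrix.det_transpose]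
  simp only [Pi.one_apply, one_mul] at h
  rw [← h]
  congr 1
  ext i j
  simp [Matrix.projVandermonde_apply]

theorem alternant_ne_zero {n : ℕ} {z : Fin n → F} (hz : Function.Injective z) :
    alternant z ≠ 0 := by
  rw [alternant_eq_prod]
  refine Finset.prod_ne_zero_iff.2 fun i _ => Finset.prod_ne_zero_iff.2 fun j hj => ?_
  exact sub_ne_zero.2 fun h => (Finset.mem_Ioi.1 hj).ne (hz h)

theorem alternant_succAbove {n : ℕ} (z : Fin (n + 1) → F) (j : Fin (n + 1)) :
    alternant z =
      (-1) ^ (j : ℕ) * (∏ i, (z j - z (j.succAbove i))) * alternant (z ∘ j.succAbove) := by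
  have hcons : alternant (fun i => z (j.cycleRange.symm i)) =
      (∏ i, (z j - z (j.succAbove i))) * alternant (z ∘ j.succAbove) := by
    rw [alternant_eq_prod, alternant_eq_prod, Fin.prod_univ_succ]
    simp [Fin.prod_Ioi_succ]
  have hperm : alternant (fun i => z (j.cycleRange.symm i)) = (-1) ^ (j : ℕ) * alternant z := by
    have h := Matrix.det_permute' j.cycleRange.symm
      (Matrix.of fun i k : Fin (n + 1) => z k ^ (i.rev : ℕ))
    rw [Equiv.Perm.sign_symm, Fin.sign_cycleRange] at h
    rw [Units.val_pow_eq_pow_val, Units.val_neg, Units.val_one, Int.cast_pow, Int.cast_neg,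
      Int.cast_one] at h
    exact h
  rw [mul_assoc, ← hcons, hperm, ← mul_assoc, ← mul_pow]
  simp

theorem prod_sub_one_eq_sum {ι : Type*} [DecidableEq ι] (s : Finset ι) (y : ι → F) (hy : Set.InjOn y s)
    (hy' : ∀ i ∈ s, y i ≠ -1) :
    ∏ i ∈ s, y i - 1 =
      ∑ j ∈ s, (y j - 1) * ∏ i ∈ s.erase j, (y i * y j - 1) / (y j - y i) := by
  let v : Option ι → F := fun o => o.elim (-1) y
  let P : Polynomial F := ∏ i ∈ s, (Polynomial.C (y i) * Polynomial.X - 1)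
  have hv : Set.InjOn v (Finset.insertNone s) := by
    rintro (_ | a) ha (_ | b) hb h
    · rfl
    · exact absurd h.symm (hy' b (by simpa using hb))
    · exact absurd h (hy' a (by simpa using ha))
    · exact congrArg some (hy (by simpa using ha) (by simpa using hb) h)
  have hdeg1 : ∀ i ∈ s, (Polynomial.C (y i) * Polynomial.X - 1 : Polynomial F).natDegree ≤ 1 := by
    intro i _
    compute_degree
  have hnat : P.natDegree ≤ s.card := by
    refine (Polynomial.natDegree_prod_le _ _).trans ?_
    simpa using Finset.sum_le_card_nsmul s _ 1 hdeg1
  have hdeg : P.degree < (Finset.insertNone s).card := by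
    refine lt_of_le_of_lt Polynomial.degree_le_natDegree ?_
    rw [Finset.card_insertNone]
    exact_mod_cast Nat.lt_succ_of_le hnat
  have hcoeff : P.coeff s.card = ∏ i ∈ s, y i := by
    have := Polynomial.coeff_prod_of_natDegree_le s _ 1 hdeg1
    rw [mul_one] at this
    rw [this]
    simp [Polynomial.coeff_one]
  have hlag := Lagrange.coeff_eq_sum hv hdeg
  rw [Finset.card_insertNone, Nat.add_sub_cancel, hcoeff] at hlag
  rw [hlag, Finset.insertNone, OrderEmbedding.coe_ofMapLEIff, Finset.sum_cons]
  have hnone : P.eval (v none) /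
      ∏ j ∈ (Finset.cons none (s.map Function.Embedding.some) (by simp)).erase none,
        (v none - v j) = 1 := by
    rw [Finset.erase_cons, Finset.prod_map, Polynomial.eval_prod, ← Finset.prod_div_distrib]
    refine Finset.prod_eq_one fun i hi => ?_
    have h0 : -1 - y i ≠ 0 := fun h => hy' i hi (by linear_combination -h)
    simp only [v, Polynomial.eval_sub, Polynomial.eval_mul, Polynomial.eval_C, Polynomial.eval_X,
      Polynomial.eval_one, Option.elim, Function.Embedding.some_apply]
    rw [div_eq_one_iff_eq h0]
    ring
  rw [hnone, add_sub_cancel_left, Finset.sum_map]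
  refine Finset.sum_congr rfl fun j hj => ?_
  have hj1 : y j + 1 ≠ 0 := fun h => hy' j hj (by linear_combination h)
  have herase : (Finset.cons none (s.map Function.Embedding.some) (by simp)).erase (some j) =
      Finset.cons none ((s.erase j).map Function.Embedding.some) (by simp) := by
    ext (_ | a) <;> simp
  simp only [Function.Embedding.some_apply]
  rw [herase, Finset.prod_cons, Finset.prod_map, Polynomial.eval_prod,
    ← Finset.mul_prod_erase s _ hj, Finset.prod_div_distrib]
  simp only [v, Polynomial.eval_sub, Polynomial.eval_mul, Polynomial.eval_C, Polynomial.eval_X,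
      Polynomial.eval_one, Option.elim, Function.Embedding.some_apply, sub_neg_eq_add]
  rw [show y j * y j - 1 = (y j + 1) * (y j - 1) by ring, mul_assoc, mul_div_mul_left _ _ hj1,
    mul_div_assoc]

/-- The variables are nonzero, distinct, and no two of them (equal or not) are mutually inverse. -/
def Generic {n : ℕ} (y : Fin n → F) : Prop :=
  Function.Injective y ∧ (∀ i, y i ≠ 0) ∧ ∀ i j, y i * y j ≠ 1

/-- Invert the variables at the positions where `ε` is false. -/
def signPow {n : ℕ} (y : Fin n → F) (ε : Fin n → Bool) : Fin n → F :=
  fun j => if ε j then y j else (y j)⁻¹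

theorem Generic.comp {n k : ℕ} {y : Fin n → F} (hy : Generic y) {e : Fin k → Fin n}
    (he : Function.Injective e) : Generic (y ∘ e) :=
  ⟨hy.1.comp he, fun i => hy.2.1 (e i), fun i j => hy.2.2 (e i) (e j)⟩

theorem Generic.signPow {n : ℕ} {y : Fin n → F} (hy : Generic y) (ε : Fin n → Bool) :
    Generic (signPow y ε) := by
  obtain ⟨hinj, h0, h1⟩ := hy
  refine ⟨fun i j hij => ?_, fun i => ?_, fun i j hij => ?_⟩
  · have hi := h0 i
    have hj := h0 j
    have hij' := h1 i j
    simp only [_root_.signPow] at hij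
    split_ifs at hij
    · exact hinj hij
    · exact absurd (by rw [hij, inv_mul_cancel₀ hj]) hij'
    · exact absurd (by rw [← hij, mul_inv_cancel₀ hi]) hij'
    · exact hinj (inv_injective hij)
  · simp only [_root_.signPow]
    split_ifs
    · exact h0 i
    · exact inv_ne_zero (h0 i)
  · have hi := h0 i
    have hj := h0 j
    have hij' := h1 i j
    simp only [_root_.signPow] at hij
    by_cases hεi : ε i <;> by_cases hεj : ε j <;> simp only [hεi, hεj, if_true, if_false,
      Bool.false_eq_true] at hij
    · exact hij' hij
    · have e : i = j := hinj ((mul_inv_eq_one₀ hj).1 hij)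
      exact absurd (e ▸ hεi) hεj
    · have e : i = j := hinj ((inv_mul_eq_one₀ hi).1 hij)
      exact absurd (e ▸ hεj) (e ▸ hεi)
    · rw [← mul_inv, inv_eq_one] at hij
      exact hij' hij

/-- Up to monomial factors, the alternant of odd orthogonal type for the weight
`((p - 1) / 2) ^ n`. -/
def oddAlternant {n : ℕ} (p : ℕ) (y : Fin n → F) : F :=
  Matrix.det (Matrix.of fun i j : Fin n => y j ^ (p + n + (i.rev : ℕ)) - y j ^ ((i : ℕ) + 1))

theorem oddAlternant_zero {n : ℕ} (y : Fin (n + 1) → F) : oddAlternant 0 y = 0 := by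
  refine Matrix.det_eq_zero_of_row_eq_zero (Fin.last n) fun j => ?_
  simp

theorem oddAlternant_eq_sum {n : ℕ} (p : ℕ) {y : Fin n → F} (h0 : ∀ i, y i ≠ 0) :
    oddAlternant p y = ∑ ε : Fin n → Bool,
      (∏ j, if ε j then y j ^ (p + n) else -y j ^ n) * alternant (signPow y ε) := by
  have h := det_add_eq_sum (F := F) (n := n) fun b => Matrix.of fun i j =>
    (if b then y j ^ (p + n) else -y j ^ n) * (if b then y j else (y j)⁻¹) ^ (i.rev : ℕ)
  refine Eq.trans (congrArg Matrix.det ?_) (h.trans (Finset.sum_congr rfl fun ε _ => ?_))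
  · ext i j
    have hi : n = (i + 1) + (i.rev : ℕ) := by rw [Fin.val_rev]; omega
    have hj := h0 j
    simp only [Matrix.of_apply, if_true, Bool.false_eq_true, if_false]
    rw [← pow_add, inv_pow, neg_mul, ← sub_eq_add_neg]
    congr 1
    rw [eq_mul_inv_iff_mul_eq₀ (pow_ne_zero _ hj), ← pow_add, ← hi]
  · exact Matrix.det_mul_row (fun j => if ε j then y j ^ (p + n) else -y j ^ n)
      (Matrix.of fun i j => signPow y ε j ^ (i.rev : ℕ))

theorem prod_univ_erase_eq_prod_succAbove {n : ℕ} (f : Fin (n + 1) → F) (j : Fin (n + 1)) :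
    ∏ i ∈ Finset.univ.erase j, f i = ∏ i, f (j.succAbove i) := by
  rw [Fin.univ_succAbove n j, Finset.erase_cons, Finset.prod_map]
  rfl

theorem alternant_signPow_eq_sum {n : ℕ} {y : Fin (n + 1) → F} (hy : Generic y)
    (ε : Fin (n + 1) → Bool) :
    ((∏ j, if ε j then y j else 1) - 1) * (∏ j, if ε j then 1 else y j) *
        alternant (signPow y ε) =
      ∑ j, if ε j then (-1) ^ (j : ℕ) * (y j - 1) * (∏ i, (y (j.succAbove i) * y j - 1)) *
        alternant (signPow (y ∘ j.succAbove) (ε ∘ j.succAbove)) else 0 := by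
  rw [← Finset.prod_filter, ← Finset.sum_filter, prod_sub_one_eq_sum _ _ hy.1.injOn,
    Finset.sum_mul, Finset.sum_mul]
  · refine Finset.sum_congr rfl fun j hj => ?_
    have hεj : ε j = true := (Finset.mem_filter.1 hj).2
    have key : (∏ i ∈ (Finset.univ.filter fun j => ε j = true).erase j,
          (y i * y j - 1) / (y j - y i)) * (∏ i, if ε i then 1 else y i) *
          (∏ i, (signPow y ε j - signPow y ε (j.succAbove i))) =
        ∏ i, (y (j.succAbove i) * y j - 1) := by
      rw [← Finset.filter_erase, Finset.prod_filter,
        prod_univ_erase_eq_prod_succAbove, Fin.prod_univ_succAbove _ j, if_pos hεj, one_mul,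
        ← Finset.prod_mul_distrib, ← Finset.prod_mul_distrib]
      refine Finset.prod_congr rfl fun i _ => ?_
      have hne : y j ≠ y (j.succAbove i) := fun h => Fin.succAbove_ne j i (hy.1 h).symm
      have h0 := hy.2.1 (j.succAbove i)
      simp only [signPow, hεj, if_true]
      split_ifs
      · rw [mul_one, div_mul_cancel₀ _ (sub_ne_zero.2 hne)]
      · field_simp
    rw [alternant_succAbove (signPow y ε) j, ← key]
    have hcomp : signPow y ε ∘ j.succAbove = signPow (y ∘ j.succAbove) (ε ∘ j.succAbove) := rfl
    rw [hcomp]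
    ring
  · intro i _ h
    exact hy.2.2 i i (by rw [h]; ring)

theorem sum_ite_comp_succAbove {n : ℕ} (j : Fin (n + 1)) (f : (Fin n → Bool) → F) :
    ∑ ε : Fin (n + 1) → Bool, (if ε j then f (ε ∘ j.succAbove) else 0) = ∑ ε, f ε := by
  rw [← (Fin.insertNthEquiv (fun _ => Bool) j).sum_comp, Fintype.sum_prod_type]
  simp [Function.comp_def]

theorem oddAlternant_succ_sub {n : ℕ} (p : ℕ) {y : Fin (n + 1) → F} (hy : Generic y) :
    oddAlternant (p + 1) y - oddAlternant p y =
      ∑ j : Fin (n + 1), (-1) ^ (j : ℕ) * y j ^ (p + n + 1) * (y j - 1) *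
        (∏ i, (y (j.succAbove i) * y j - 1)) * oddAlternant (p + 1) (y ∘ j.succAbove) := by
  have hrhs : ∀ j : Fin (n + 1), (-1) ^ (j : ℕ) * y j ^ (p + n + 1) * (y j - 1) *
        (∏ i, (y (j.succAbove i) * y j - 1)) * oddAlternant (p + 1) (y ∘ j.succAbove) =
      ∑ ε : Fin (n + 1) → Bool, if ε j then (-1) ^ (j : ℕ) * y j ^ (p + n + 1) * (y j - 1) *
        (∏ i, (y (j.succAbove i) * y j - 1)) *
        ((∏ i, if ε (j.succAbove i) then y (j.succAbove i) ^ (p + 1 + n)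
            else -y (j.succAbove i) ^ n) *
          alternant (signPow (y ∘ j.succAbove) (ε ∘ j.succAbove))) else 0 := by
    intro j
    rw [oddAlternant_eq_sum _ (hy.comp j.succAbove_right_injective).2.1, Finset.mul_sum]
    exact (sum_ite_comp_succAbove j fun ε => (-1) ^ (j : ℕ) * y j ^ (p + n + 1) * (y j - 1) *
        (∏ i, (y (j.succAbove i) * y j - 1)) *
        ((∏ i, if ε i then (y ∘ j.succAbove) i ^ (p + 1 + n) else -(y ∘ j.succAbove) i ^ n) *
          alternant (signPow (y ∘ j.succAbove) ε))).symm
  rw [Finset.sum_congr rfl fun j _ => hrhs j, Finset.sum_comm, oddAlternant_eq_sum _ hy.2.1,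
    oddAlternant_eq_sum _ hy.2.1, ← Finset.sum_sub_distrib]
  refine Finset.sum_congr rfl fun ε _ => ?_
  let c : Fin (n + 1) → F := fun j => if ε j then y j ^ (p + n + 1) else -y j ^ n
  have h1 : (∏ j, if ε j then y j ^ (p + 1 + (n + 1)) else -y j ^ (n + 1)) =
      (∏ j, if ε j then y j else 1) * (∏ j, if ε j then 1 else y j) * ∏ j, c j := by
    rw [← Finset.prod_mul_distrib, ← Finset.prod_mul_distrib]
    refine Finset.prod_congr rfl fun j _ => ?_
    simp only [c]
    split_ifs <;> ring
  have h2 : (∏ j, if ε j then y j ^ (p + (n + 1)) else -y j ^ (n + 1)) =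
      (∏ j, if ε j then 1 else y j) * ∏ j, c j := by
    rw [← Finset.prod_mul_distrib]
    refine Finset.prod_congr rfl fun j _ => ?_
    simp only [c]
    split_ifs <;> ring
  rw [h1, h2]
  calc _ = (∏ j, c j) * (((∏ j, if ε j then y j else 1) - 1) * (∏ j, if ε j then 1 else y j) *
        alternant (signPow y ε)) := by ring
    _ = _ := by
      rw [alternant_signPow_eq_sum hy, Finset.mul_sum]
      refine Finset.sum_congr rfl fun j _ => ?_
      split_ifs with hεj
      · rw [Fin.prod_univ_succAbove _ j]
        have hc : c j = y j ^ (p + n + 1) := if_pos hεj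
        have hc' : (∏ i, if ε (j.succAbove i) then y (j.succAbove i) ^ (p + 1 + n)
            else -y (j.succAbove i) ^ n) = ∏ i, c (j.succAbove i) := by
          simp only [c, add_right_comm p 1 n]
        rw [hc, hc']
        ring
      · simp

/-- The sum over partitions in the `n × (p - 1)` box of the alternants `det (y_j ^ (λ_i + n - i))`. -/
def alternantSum {n : ℕ} (p : ℕ) (y : Fin n → F) : F :=
  ∑ lam ∈ Finset.univ.filter (fun lam : Fin n → Fin p => Antitone fun i => (lam i : ℕ)),
    Matrix.det (Matrix.of fun i j : Fin n => y j ^ ((lam i : ℕ) + (i.rev : ℕ)))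

theorem alternantSum_one {n : ℕ} (y : Fin n → F) : alternantSum 1 y = alternant y := by
  have : (Finset.univ.filter fun lam : Fin n → Fin 1 => Antitone fun i => (lam i : ℕ)) =
      {fun _ => 0} := by
    ext lam
    have : lam = fun _ => 0 := Subsingleton.elim _ _
    subst this
    simp [antitone_const]
  rw [alternantSum, this, Finset.sum_singleton]
  simp [alternant]

theorem alternantSum_succ {n : ℕ} (p : ℕ) (y : Fin (n + 1) → F) :
    alternantSum (p + 1) y = alternantSum p y +
      ∑ j : Fin (n + 1), (-1) ^ (j : ℕ) * y j ^ (p + n) *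
        alternantSum (p + 1) (y ∘ j.succAbove) := by
  have hlow : ∑ lam ∈ (Finset.univ.filter
        (fun lam : Fin (n + 1) → Fin (p + 1) => Antitone fun i => (lam i : ℕ))) with
          ¬ lam 0 = Fin.last p,
        Matrix.det (Matrix.of fun i j => y j ^ ((lam i : ℕ) + (i.rev : ℕ))) =
      alternantSum p y := by
    symm
    refine Finset.sum_bij (fun lam _ i => (lam i).castSucc) ?_ ?_ ?_ ?_
    · intro lam hlam
      simp only [Finset.mem_filter, Finset.mem_univ, true_and] at hlam ⊢
      exact ⟨hlam, (Fin.castSucc_lt_last _).ne⟩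
    · intro a _ b _ hab
      funext i
      exact Fin.castSucc_injective _ (congrFun hab i)
    · intro lam hlam
      simp only [Finset.mem_filter, Finset.mem_univ, true_and] at hlam
      have hlt : ∀ i, (lam i : ℕ) < p := fun i =>
        (hlam.1 (Fin.zero_le i)).trans_lt (Fin.lt_last_iff_ne_last.2 hlam.2)
      exact ⟨fun i => ⟨lam i, hlt i⟩, by simpa using hlam.1, rfl⟩
    · intro lam _
      rfl
  have hhigh : ∑ lam ∈ (Finset.univ.filter
        (fun lam : Fin (n + 1) → Fin (p + 1) => Antitone fun i => (lam i : ℕ))) with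
          lam 0 = Fin.last p,
        Matrix.det (Matrix.of fun i j => y j ^ ((lam i : ℕ) + (i.rev : ℕ))) =
      ∑ lam ∈ Finset.univ.filter
          (fun lam : Fin n → Fin (p + 1) => Antitone fun i => (lam i : ℕ)),
        ∑ j : Fin (n + 1), (-1) ^ (j : ℕ) * y j ^ (p + n) *
          Matrix.det (Matrix.of fun i k : Fin n =>
            y (j.succAbove k) ^ ((lam i : ℕ) + (i.rev : ℕ))) := by
    refine Finset.sum_bij' (fun lam _ => Fin.tail lam)
      (fun lam _ => Fin.cons (Fin.last p) lam) ?_ ?_ ?_ ?_ ?_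
    · intro lam hlam
      simp only [Finset.mem_filter, Finset.mem_univ, true_and] at hlam ⊢
      exact fun i j hij => hlam.1 (Fin.succ_le_succ_iff.2 hij)
    · intro lam hlam
      simp only [Finset.mem_filter, Finset.mem_univ, true_and] at hlam ⊢
      refine ⟨fun i j hij => ?_, rfl⟩
      induction i using Fin.cases with
      | zero => exact Fin.le_last _
      | succ i =>
        induction j using Fin.cases with
        | zero => exact absurd hij (by simp)
        | succ j => exact hlam (Fin.succ_le_succ_iff.1 hij)
    · intro lam hlam
      simp only [Finset.mem_filter, Finset.mem_univ, true_and] at hlam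
      simp only [← hlam.2, Fin.cons_self_tail]
    · intro lam _
      exact Fin.tail_cons _ _
    · intro lam hlam
      simp only [Finset.mem_filter, Finset.mem_univ, true_and] at hlam
      rw [Matrix.det_succ_row_zero]
      refine Finset.sum_congr rfl fun j _ => ?_
      congr 1
      · simp [hlam.2]
      · congr 1
        ext i k
        simp [Fin.tail]
  rw [alternantSum, ← Finset.sum_filter_add_sum_filter_not _ (fun lam => lam 0 = Fin.last p),
    hlow, hhigh, add_comm, Finset.sum_comm]
  congr 1
  refine Finset.sum_congr rfl fun j _ => ?_
  rw [alternantSum, Finset.mul_sum]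
  rfl

/-- The product `∏ y_i (y_i - 1) ∏_{i < j} (y_i y_j - 1)`, written as a quotient of alternants. -/
def littlewoodFactor {n : ℕ} (y : Fin n → F) : F :=
  (∏ i, y i ^ n * (y i - 1)) * alternant (fun i => y i + (y i)⁻¹) / alternant y

theorem add_inv_sub_add_inv {a b : F} (ha : a ≠ 0) (hb : b ≠ 0) :
    a * b * ((a + a⁻¹) - (b + b⁻¹)) = (b * a - 1) * (a - b) := by
  field_simp
  ring

theorem littlewoodFactor_ne_zero {n : ℕ} {y : Fin n → F} (hy : Generic y) :
    littlewoodFactor y ≠ 0 := by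
  have hinj : Function.Injective fun i => y i + (y i)⁻¹ := by
    intro i j hij
    have h := add_inv_sub_add_inv (hy.2.1 i) (hy.2.1 j)
    rw [sub_eq_zero.2 hij, mul_zero, eq_comm, mul_eq_zero] at h
    exact hy.1 (sub_eq_zero.1 (h.resolve_left (sub_ne_zero.2 (hy.2.2 j i))))
  refine div_ne_zero (mul_ne_zero (Finset.prod_ne_zero_iff.2 fun i _ => ?_)
    (alternant_ne_zero hinj)) (alternant_ne_zero hy.1)
  exact mul_ne_zero (pow_ne_zero _ (hy.2.1 i))
    (sub_ne_zero.2 fun h => hy.2.2 i i (by rw [h, one_mul]))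

theorem littlewoodFactor_succAbove {n : ℕ} {y : Fin (n + 1) → F} (hy : Generic y)
    (j : Fin (n + 1)) :
    littlewoodFactor y = y j * (y j - 1) * (∏ i, (y (j.succAbove i) * y j - 1)) *
      littlewoodFactor (y ∘ j.succAbove) := by
  have hV := alternant_ne_zero (hy.comp j.succAbove_right_injective).1
  have hD : ∏ i, (y j - y (j.succAbove i)) ≠ 0 := Finset.prod_ne_zero_iff.2 fun i _ =>
    sub_ne_zero.2 fun h => Fin.succAbove_ne j i (hy.1 h).symm
  have key : y j ^ n * (∏ i, y (j.succAbove i)) *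
      (∏ i, ((y j + (y j)⁻¹) - (y (j.succAbove i) + (y (j.succAbove i))⁻¹))) =
      (∏ i, (y (j.succAbove i) * y j - 1)) * ∏ i, (y j - y (j.succAbove i)) := by
    rw [← Fin.prod_const, ← Finset.prod_mul_distrib, ← Finset.prod_mul_distrib,
      ← Finset.prod_mul_distrib]
    exact Finset.prod_congr rfl fun i _ => add_inv_sub_add_inv (hy.2.1 _) (hy.2.1 _)
  have hpow : ∏ i, y i ^ (n + 1) * (y i - 1) = y j ^ (n + 1) * (y j - 1) *
      ((∏ i, y (j.succAbove i)) * ∏ i, y (j.succAbove i) ^ n * (y (j.succAbove i) - 1)) := by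
    rw [Fin.prod_univ_succAbove _ j, ← Finset.prod_mul_distrib]
    congr 1
    exact Finset.prod_congr rfl fun i _ => by ring
  have hsign : ((-1 : F) ^ (j : ℕ)) ≠ 0 := pow_ne_zero _ (by simp)
  rw [littlewoodFactor, littlewoodFactor, hpow, alternant_succAbove _ j,
    alternant_succAbove y j]
  simp only [Function.comp_def] at hV ⊢
  rw [mul_div_assoc', div_eq_div_iff (mul_ne_zero (mul_ne_zero hsign hD) hV) hV]
  linear_combination ((-1) ^ (j : ℕ) * y j * (y j - 1) *
    (∏ i, y (j.succAbove i) ^ n * (y (j.succAbove i) - 1)) *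
    alternant (fun i => y (j.succAbove i) + (y (j.succAbove i))⁻¹) *
    alternant (fun i => y (j.succAbove i))) * key

/-- The bounded Littlewood identity of odd orthogonal type. -/
theorem alternantSum_mul_littlewoodFactor {n : ℕ} (p : ℕ) {y : Fin n → F} (hy : Generic y) :
    alternantSum p y * littlewoodFactor y = oddAlternant p y := by
  induction n generalizing p with
  | zero =>
    have : (Finset.univ.filter fun lam : Fin 0 → Fin p => Antitone fun i => (lam i : ℕ)) =
        Finset.univ := Finset.filter_true_of_mem fun lam _ i => i.elim0
    rw [alternantSum, this]
    simp [littlewoodFactor, oddAlternant, alternant]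
  | succ n ih =>
    induction p with
    | zero => simp [alternantSum, oddAlternant_zero]
    | succ p ihp =>
      rw [sub_eq_iff_eq_add'.1 (oddAlternant_succ_sub p hy), alternantSum_succ, add_mul, ihp, Finset.sum_mul]
      congr 1
      refine Finset.sum_congr rfl fun j _ => ?_
      rw [littlewoodFactor_succAbove hy j, ← ih _ (hy.comp j.succAbove_right_injective)]
      ring

theorem alternantSum_mul_oddAlternant_one {n : ℕ} (p : ℕ) {y : Fin n → F} (hy : Generic y) :
    alternantSum p y * oddAlternant 1 y = alternant y * oddAlternant p y := by
  rw [← alternantSum_mul_littlewoodFactor 1 hy, ← alternantSum_mul_littlewoodFactor p hy,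
    alternantSum_one]
  ring

theorem oddAlternant_one_ne_zero {n : ℕ} {y : Fin n → F} (hy : Generic y) :
    oddAlternant 1 y ≠ 0 := by
  rw [← alternantSum_mul_littlewoodFactor 1 hy, alternantSum_one]
  exact mul_ne_zero (alternant_ne_zero hy.1) (littlewoodFactor_ne_zero hy)

/-- Up to monomial factors, the alternant of symplectic type for the weight `(m / 2) ^ n`. -/
def symplecticAlternant {n : ℕ} (m : ℕ) (x : Fin n → F) : F :=
  Matrix.det (Matrix.of fun i j : Fin n => x j ^ (m + n + 1 + (i.rev : ℕ)) - x j ^ (i : ℕ))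

theorem symplecticAlternant_eq_sum {n : ℕ} (m : ℕ) {x : Fin n → F} (h0 : ∀ i, x i ≠ 0) :
    symplecticAlternant m x = ∑ ε : Fin n → Bool,
      (∏ j, if ε j then x j ^ (m + n + 1) else -(x j ^ n * (x j)⁻¹)) *
        alternant (signPow x ε) := by
  have h := det_add_eq_sum (F := F) (n := n) fun b => Matrix.of fun i j =>
    (if b then x j ^ (m + n + 1) else -(x j ^ n * (x j)⁻¹)) *
      (if b then x j else (x j)⁻¹) ^ (i.rev : ℕ)
  refine Eq.trans (congrArg Matrix.det ?_) (h.trans (Finset.sum_congr rfl fun ε _ => ?_))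
  · ext i j
    have hi : n = i + ((i.rev : ℕ) + 1) := by rw [Fin.val_rev]; omega
    have hj := h0 j
    simp only [Matrix.of_apply, if_true, Bool.false_eq_true, if_false]
    rw [← pow_add, neg_mul, ← sub_eq_add_neg, mul_assoc, ← pow_succ', inv_pow]
    congr 1
    rw [eq_mul_inv_iff_mul_eq₀ (pow_ne_zero _ hj), ← pow_add, ← hi]
  · exact Matrix.det_mul_row
      (fun j => if ε j then x j ^ (m + n + 1) else -(x j ^ n * (x j)⁻¹))
      (Matrix.of fun i j => signPow x ε j ^ (i.rev : ℕ))

theorem oddAlternant_signPow {n : ℕ} (p : ℕ) {x : Fin n → F} (h0 : ∀ i, x i ≠ 0)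
    (ε : Fin n → Bool) :
    oddAlternant p (signPow x ε) =
      (∏ j, if ε j then 1 else -((x j)⁻¹ ^ (p + 2 * n))) * oddAlternant p x := by
  refine Eq.trans (congrArg Matrix.det ?_) (Matrix.det_mul_row
    (fun j => if ε j then 1 else -((x j)⁻¹ ^ (p + 2 * n)))
    (Matrix.of fun i j => x j ^ (p + n + (i.rev : ℕ)) - x j ^ ((i : ℕ) + 1)))
  ext i j
  have hi : p + 2 * n = (p + n + (i.rev : ℕ)) + (i + 1) := by rw [Fin.val_rev]; omega
  have hj := h0 j
  simp only [Matrix.of_apply, signPow, hi]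
  split_ifs
  · rw [one_mul]
  · have ha := pow_ne_zero (p + n + (i.rev : ℕ)) hj
    have hb := pow_ne_zero ((i : ℕ) + 1) hj
    rw [pow_add _ (p + n + (i.rev : ℕ)), inv_pow, inv_pow]
    generalize x j ^ (p + n + (i.rev : ℕ)) = a at *
    generalize x j ^ ((i : ℕ) + 1) = b at *
    field_simp
    ring

theorem alternantSum_signPow {n : ℕ} (m : ℕ) {x : Fin n → F} (hx : Generic x)
    (ε : Fin n → Bool) :
    alternantSum (m + 1) (signPow x ε) * oddAlternant 1 x =
      (∏ j, if ε j then 1 else (x j)⁻¹ ^ m) * alternant (signPow x ε) *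
        oddAlternant (m + 1) x := by
  have h := alternantSum_mul_oddAlternant_one (m + 1) (hx.signPow ε)
  have hsplit : (∏ j, if ε j then 1 else -((x j)⁻¹ ^ (m + 1 + 2 * n))) =
      (∏ j, if ε j then 1 else (x j)⁻¹ ^ m) *
        ∏ j, if ε j then 1 else -((x j)⁻¹ ^ (1 + 2 * n)) := by
    rw [← Finset.prod_mul_distrib]
    refine Finset.prod_congr rfl fun j _ => ?_
    split_ifs
    · rw [mul_one]
    · ring
  have hne : (∏ j, if ε j then 1 else -((x j)⁻¹ ^ (1 + 2 * n))) ≠ 0 := by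
    refine Finset.prod_ne_zero_iff.2 fun j _ => ?_
    split_ifs
    · exact one_ne_zero
    · exact neg_ne_zero.2 (pow_ne_zero _ (inv_ne_zero (hx.2.1 j)))
  rw [oddAlternant_signPow _ hx.2.1, oddAlternant_signPow _ hx.2.1, hsplit] at h
  refine mul_left_cancel₀ hne ?_
  linear_combination h

/-- The numerator of the symplectic character, summed over partitions in the `n × m` box. -/
theorem sum_symplectic_numerator {n : ℕ} (m : ℕ) {x : Fin n → F} (hx : Generic x) :
    (∑ lam ∈ Finset.univ.filter
        (fun lam : Fin n → Fin (m + 1) => Antitone fun i => (lam i : ℕ)),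
      Matrix.det (Matrix.of fun i j : Fin n =>
        x j ^ (((lam i : ℕ) : ℤ) + (n : ℤ) - (i : ℕ)) -
          x j ^ (-(((lam i : ℕ) : ℤ) + (n : ℤ) - (i : ℕ))))) *
        oddAlternant 1 x * ∏ j, x j ^ (m + n) =
      symplecticAlternant m x * oddAlternant (m + 1) x := by
  have hdet : ∀ lam : Fin n → Fin (m + 1), Matrix.det (Matrix.of fun i j : Fin n =>
        x j ^ (((lam i : ℕ) : ℤ) + (n : ℤ) - (i : ℕ)) -
          x j ^ (-(((lam i : ℕ) : ℤ) + (n : ℤ) - (i : ℕ)))) =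
      ∑ ε : Fin n → Bool, (∏ j, if ε j then x j else -(x j)⁻¹) *
        Matrix.det (Matrix.of fun i j : Fin n =>
          signPow x ε j ^ ((lam i : ℕ) + (i.rev : ℕ))) := by
    intro lam
    have h := det_add_eq_sum (F := F) (n := n) fun b => Matrix.of fun i j =>
      (if b then x j else -(x j)⁻¹) *
        (if b then x j else (x j)⁻¹) ^ ((lam i : ℕ) + (i.rev : ℕ))
    refine Eq.trans (congrArg Matrix.det ?_) (h.trans (Finset.sum_congr rfl fun ε _ => ?_))
    · ext i j
      have hi : ((lam i : ℕ) : ℤ) + (n : ℤ) - (i : ℕ) =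
          (((lam i : ℕ) + (i.rev : ℕ) + 1 : ℕ) : ℤ) := by
        rw [Fin.val_rev]
        omega
      simp only [Matrix.of_apply, if_true, Bool.false_eq_true, if_false]
      rw [hi, _root_.zpow_neg, zpow_natCast, pow_succ', neg_mul, ← sub_eq_add_neg, mul_inv,
        inv_pow]
    · exact Matrix.det_mul_row (fun j => if ε j then x j else -(x j)⁻¹)
        (Matrix.of fun i j => signPow x ε j ^ ((lam i : ℕ) + (i.rev : ℕ)))
  rw [Finset.sum_congr rfl fun lam _ => hdet lam, Finset.sum_comm]
  simp only [← Finset.mul_sum]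
  rw [symplecticAlternant_eq_sum m hx.2.1, Finset.sum_mul, Finset.sum_mul, Finset.sum_mul]
  refine Finset.sum_congr rfl fun ε _ => ?_
  have hcoef : (∏ j, if ε j then x j ^ (m + n + 1) else -(x j ^ n * (x j)⁻¹)) =
      (∏ j, if ε j then x j else -(x j)⁻¹) * (∏ j, if ε j then 1 else (x j)⁻¹ ^ m) *
        ∏ j, x j ^ (m + n) := by
    rw [← Finset.prod_mul_distrib, ← Finset.prod_mul_distrib]
    refine Finset.prod_congr rfl fun j _ => ?_
    have hj := hx.2.1 j
    split_ifs
    · ring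
    · rw [pow_add, inv_pow]
      field_simp
  have h := alternantSum_signPow m hx ε
  rw [alternantSum] at h
  rw [hcoef]
  linear_combination ((∏ j, if ε j then x j else -(x j)⁻¹) * ∏ j, x j ^ (m + n)) * h

theorem exists_det_submatrix_equiv_eq_mul {ι κ : Type*} [Fintype ι] [DecidableEq ι] [Fintype κ]
    [DecidableEq κ] (e f : ι ≃ κ) :
    ∃ c : F, c ≠ 0 ∧ ∀ M : Matrix κ κ F, (M.submatrix e f).det = c * M.det := by
  refine ⟨((Equiv.Perm.sign (e.symm.trans f) : ℤ) : F), ?_, fun M => ?_⟩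
  · rcases Int.units_eq_one_or (Equiv.Perm.sign (e.symm.trans f)) with h | h <;> simp [h]
  · rw [← Matrix.det_permute', ← Matrix.det_submatrix_equiv_self e]
    congr 1
    ext i j
    simp

/-- The numerator of the rectangular Schur function in the variables `x`, their inverses, and `1`,
with rows paired so that exponents in a pair add up to `m + 2 * n`. -/
def pairedMatrix {n : ℕ} (m : ℕ) (x : Fin n → F) :
    Matrix (Fin n ⊕ Fin (n + 1)) (Fin n ⊕ Fin (n + 1)) F :=
  Matrix.of fun a b =>
    Sum.elim x (Fin.snoc (fun j => (x j)⁻¹) 1 : Fin (n + 1) → F) b ^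
      Sum.elim (fun i : Fin n => m + n + 1 + (i.rev : ℕ)) (fun k : Fin (n + 1) => (k : ℕ)) a

/-- The even block left after eliminating the odd part from `pairedMatrix`. -/
def evenBlock {n : ℕ} (m : ℕ) (x : Fin n → F) : Matrix (Fin (n + 1)) (Fin (n + 1)) F :=
  Matrix.of fun k l =>
    (Fin.snoc (fun j => x j ^ (m + n + (k.rev : ℕ)) + x j ^ (k : ℕ)) 1 : Fin (n + 1) → F) l

theorem det_evenBlock {n : ℕ} (m : ℕ) (x : Fin n → F) :
    (evenBlock m x).det * ∏ j, x j =
      (-1) ^ n * (∏ j, (1 - x j)) * oddAlternant (m + 1) x := by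
  let B : Matrix (Fin (n + 1)) (Fin (n + 1)) F := Matrix.of fun k l =>
    Fin.cases (evenBlock m x 0 l)
      (fun i => evenBlock m x i.succ l - evenBlock m x i.castSucc l) k
  have hB : (evenBlock m x).det = B.det :=
    Matrix.det_eq_of_forall_row_eq_smul_add_pred (fun _ => 1) (fun _ => rfl) fun i j => by
      simp [B]
  have hlast : ∀ i : Fin n, B i.succ (Fin.last n) = 0 := fun i => by
    simp [B, evenBlock]
  have hsub : (B.submatrix Fin.succ Fin.castSucc).det * ∏ j, x j =
      (∏ j, (1 - x j)) * oddAlternant (m + 1) x := by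
    rw [mul_comm, ← Matrix.det_mul_row, oddAlternant, ← Matrix.det_mul_row]
    congr 1
    ext i j
    have h1 : ((i.castSucc.rev : Fin (n + 1)) : ℕ) = (i.rev : ℕ) + 1 := by simp [Fin.rev_castSucc]
    have h2 : ((i.succ.rev : Fin (n + 1)) : ℕ) = (i.rev : ℕ) := by simp [Fin.rev_succ]
    simp only [B, evenBlock, Matrix.of_apply, Matrix.submatrix_apply, Fin.cases_succ,
      Fin.snoc_castSucc, h1, h2, Fin.val_succ, Fin.val_castSucc]
    ring
  rw [hB, Matrix.det_succ_column B (Fin.last n), Fin.sum_univ_succ]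
  simp only [hlast, mul_zero, zero_mul, Finset.sum_const_zero, add_zero]
  have h0 : B 0 (Fin.last n) = 1 := by simp [B, evenBlock]
  rw [h0, mul_one, mul_assoc, mul_assoc, ← hsub]
  simp [Fin.succAbove_last]

theorem det_pairedMatrix {n : ℕ} (m : ℕ) {x : Fin n → F} (h0 : ∀ i, x i ≠ 0) :
    (pairedMatrix m x).det * ∏ j, x j ^ (m + 2 * n) =
      symplecticAlternant m x * (evenBlock m x).det := by
  let E : Matrix (Fin n) (Fin (n + 1)) F := Matrix.of fun i k => if k = i.castSucc then 1 else 0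
  let d : Fin (n + 1) → F := Fin.snoc (fun j => x j ^ (m + 2 * n)) 1
  let A := (pairedMatrix m x).toBlocks₁₁
  let C := (pairedMatrix m x).toBlocks₂₁
  have hEmul : ∀ (l : ℕ) (X : Matrix (Fin (n + 1)) (Fin l) F) i j,
      (E * X) i j = X i.castSucc j := by
    intro l X i j
    simp [E, Matrix.mul_apply]
  have hmulE : ∀ (l : ℕ) (X : Matrix (Fin l) (Fin n) F) i j,
      (X * E) i (Fin.castSucc j) = X i j := by
    intro l X i j
    simp [E, Matrix.mul_apply]
  have hmulE' : ∀ (l : ℕ) (X : Matrix (Fin l) (Fin n) F) i,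
      (X * E) i (Fin.last n) = 0 := by
    intro l X i
    simp [E, Matrix.mul_apply, (Fin.castSucc_lt_last _).ne']
  have hprod : Matrix.fromBlocks 1 (-E) 0 1 * pairedMatrix m x *
      Matrix.fromBlocks 1 E 0 (Matrix.diagonal d) =
      Matrix.fromBlocks (A - E * C) 0 C (evenBlock m x) := by
    rw [← Matrix.fromBlocks_toBlocks (pairedMatrix m x), Matrix.fromBlocks_multiply,
      Matrix.fromBlocks_multiply]
    simp only [Matrix.one_mul, Matrix.mul_one, Matrix.zero_mul, Matrix.mul_zero, zero_add,
      add_zero, Matrix.neg_mul, ← sub_eq_add_neg]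
    refine congrArg₂ (fun P Q => Matrix.fromBlocks (A - E * C) P C Q) ?_ ?_
    · ext i k
      rw [Matrix.add_apply, Matrix.mul_diagonal]
      induction k using Fin.lastCases with
      | last =>
        rw [hmulE', Matrix.sub_apply, hEmul]
        simp [Matrix.toBlocks₁₂, Matrix.toBlocks₂₂, pairedMatrix]
      | cast j =>
        have hi : m + 2 * n = (m + n + 1 + (i.rev : ℕ)) + i := by rw [Fin.val_rev]; omega
        have hj := h0 j
        rw [hmulE, Matrix.sub_apply, hEmul, Matrix.sub_apply, hEmul]
        simp only [Matrix.toBlocks₁₁, Matrix.toBlocks₁₂, Matrix.toBlocks₂₁, Matrix.toBlocks₂₂,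
          pairedMatrix, Matrix.of_apply, Sum.elim_inl, Sum.elim_inr, Fin.snoc_castSucc, d,
          Fin.val_castSucc, Matrix.zero_apply]
        have ha := pow_ne_zero (m + n + 1 + (i.rev : ℕ)) hj
        have hb := pow_ne_zero (i : ℕ) hj
        rw [hi, pow_add _ (m + n + 1 + (i.rev : ℕ))]
        simp only [inv_pow]
        generalize x j ^ (m + n + 1 + (i.rev : ℕ)) = a at *
        generalize x j ^ (i : ℕ) = b at *
        field_simp
        ring
    · ext k l
      rw [Matrix.add_apply, Matrix.mul_diagonal]
      induction l using Fin.lastCases with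
      | last =>
        rw [hmulE']
        simp [Matrix.toBlocks₂₂, pairedMatrix, evenBlock, d]
      | cast j =>
        have hk : m + 2 * n = (m + n + (k.rev : ℕ)) + k := by rw [Fin.val_rev]; omega
        have hj := h0 j
        rw [hmulE]
        simp only [Matrix.toBlocks₂₁, Matrix.toBlocks₂₂, evenBlock,
          pairedMatrix, Matrix.of_apply, Sum.elim_inl, Sum.elim_inr, Fin.snoc_castSucc, d]
        have ha := pow_ne_zero (m + n + (k.rev : ℕ)) hj
        have hb := pow_ne_zero (k : ℕ) hj
        rw [hk, pow_add _ (m + n + (k.rev : ℕ))]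
        simp only [inv_pow]
        generalize x j ^ (m + n + (k.rev : ℕ)) = a at *
        generalize x j ^ (k : ℕ) = b at *
        field_simp
        ring
  have hAC : (A - E * C).det = symplecticAlternant m x := by
    refine congrArg Matrix.det ?_
    ext i j
    rw [Matrix.sub_apply, hEmul]
    rfl
  have hd : ∏ k, d k = ∏ j, x j ^ (m + 2 * n) := by
    rw [Fin.prod_univ_castSucc]
    simp [d]
  have h := congrArg Matrix.det hprod
  rw [Matrix.det_mul, Matrix.det_mul, Matrix.det_fromBlocks_zero₂₁, Matrix.det_fromBlocks_zero₂₁,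
    Matrix.det_fromBlocks_zero₁₂, Matrix.det_one, Matrix.det_one, Matrix.det_diagonal, hAC, hd] at h
  simpa using h

theorem Generic.gen (n : ℕ) : Generic (gen n) := by
  have hinj := IsFractionRing.injective (MvPolynomial (Fin n) ℚ) (FF n)
  refine ⟨fun i j hij => MvPolynomial.X_injective (hinj hij), fun i h => ?_, fun i j h => ?_⟩
  · exact MvPolynomial.X_ne_zero i (hinj (h.trans (map_zero _).symm))
  · rw [_root_.gen, _root_.gen, ← map_mul] at h
    have h' := congrArg (MvPolynomial.eval fun _ => (0 : ℚ)) (hinj (h.trans (map_one _).symm))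
    simp at h'

/-- The `i`-th row is matched with the row `2 * n - i`. -/
def pairedRows (n : ℕ) : Fin n ⊕ Fin (n + 1) ≃ Fin (2 * n + 1) :=
  Equiv.ofBijective
    (Sum.elim (fun i => ⟨i, by omega⟩) (fun k => ⟨2 * n - k, by omega⟩)) <| by
    rw [Fintype.bijective_iff_injective_and_card]
    refine ⟨?_, by simp; omega⟩
    rintro (a | a) (b | b) h <;> simp [Fin.ext_iff] at h ⊢ <;> omega

/-- The column of a variable is matched with the column of its inverse. -/
def pairedColumns (n : ℕ) : Fin n ⊕ Fin (n + 1) ≃ Fin (2 * n + 1) :=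
  Equiv.ofBijective
    (Sum.elim (fun j => ⟨2 * j, by omega⟩)
      (fun k => if h : (k : ℕ) = n then ⟨2 * n, by omega⟩ else ⟨2 * k + 1, by omega⟩)) <| by
    rw [Fintype.bijective_iff_injective_and_card]
    refine ⟨?_, by simp; omega⟩
    rintro (a | a) (b | b) h <;> simp only [Sum.elim_inl, Sum.elim_inr] at h <;>
      (try split_ifs at h) <;> simp [Fin.ext_iff] at h ⊢ <;> omega

/-- The variables `x_1, x_1⁻¹, …, x_n, x_n⁻¹, 1`. -/
def symmetricVariables {n : ℕ} (x : Fin n → F) : Fin (2 * n + 1) → F := fun j =>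
  Sum.elim x (Fin.snoc (fun j => (x j)⁻¹) 1 : Fin (n + 1) → F) ((pairedColumns n).symm j)

/-- The numerator of the Schur function of shape `(m ^ n)` in the symmetric variables. -/
def rectangularNumerator {n : ℕ} (m : ℕ) (x : Fin n → F) : F :=
  Matrix.det (Matrix.of fun i j : Fin (2 * n + 1) => symmetricVariables x j ^
    ((if (i : ℕ) < n then (m : ℤ) else 0) + ((2 * n + 1 : ℕ) : ℤ) - 1 - (i : ℕ)))

theorem submatrix_eq_pairedMatrix {n : ℕ} (m : ℕ) (x : Fin n → F) :
    (Matrix.of fun i j : Fin (2 * n + 1) => symmetricVariables x j ^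
      ((if (i : ℕ) < n then (m : ℤ) else 0) + ((2 * n + 1 : ℕ) : ℤ) - 1 - (i : ℕ))).submatrix
        (pairedRows n) (pairedColumns n) = pairedMatrix m x := by
  have hexp : ∀ a, (if (pairedRows n a : ℕ) < n then (m : ℤ) else 0) +
      ((2 * n + 1 : ℕ) : ℤ) - 1 - (pairedRows n a : ℕ) =
      ((Sum.elim (fun i : Fin n => m + n + 1 + (i.rev : ℕ))
        (fun k : Fin (n + 1) => (k : ℕ)) a : ℕ) : ℤ) := by
    rintro (i | k)
    · simp only [pairedRows, Equiv.ofBijective_apply, Sum.elim_inl, Fin.val_rev]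
      rw [if_pos i.isLt]
      omega
    · simp only [pairedRows, Equiv.ofBijective_apply, Sum.elim_inr]
      rw [if_neg (by omega)]
      omega
  ext a b
  rw [Matrix.submatrix_apply, Matrix.of_apply, hexp, symmetricVariables, Equiv.symm_apply_apply, zpow_natCast]
  rfl

theorem exists_rectangularNumerator_eq {n : ℕ} {x : Fin n → F} (hx : Generic x) :
    ∃ c : F, c ≠ 0 ∧ ∀ m, rectangularNumerator m x * ∏ j, x j ^ m =
      c * (symplecticAlternant m x * oddAlternant (m + 1) x) := by
  obtain ⟨σ, hσ, h⟩ := exists_det_submatrix_equiv_eq_mul (F := F) (pairedRows n) (pairedColumns n)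
  have h2n : ∏ j, x j ^ (2 * n) ≠ 0 := Finset.prod_ne_zero_iff.2 fun j _ =>
    pow_ne_zero _ (hx.2.1 j)
  have h1 : ∏ j, x j ≠ 0 := Finset.prod_ne_zero_iff.2 fun j _ => hx.2.1 j
  have h1x : ∏ j, (1 - x j) ≠ 0 := Finset.prod_ne_zero_iff.2 fun j _ =>
    sub_ne_zero.2 fun h => hx.2.2 j j (by rw [← h, one_mul])
  have hs : ((-1 : F)) ^ n ≠ 0 := pow_ne_zero _ (by simp)
  refine ⟨(-1) ^ n * (∏ j, (1 - x j)) / (σ * (∏ j, x j ^ (2 * n)) * ∏ j, x j),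
    div_ne_zero (mul_ne_zero hs h1x) (mul_ne_zero (mul_ne_zero hσ h2n) h1), fun m => ?_⟩
  have hm := h (Matrix.of fun i j : Fin (2 * n + 1) => symmetricVariables x j ^
    ((if (i : ℕ) < n then (m : ℤ) else 0) + ((2 * n + 1 : ℕ) : ℤ) - 1 - (i : ℕ)))
  rw [submatrix_eq_pairedMatrix] at hm
  have hp := det_pairedMatrix m hx.2.1
  have he := det_evenBlock m x
  rw [hm] at hp
  simp only [pow_add, Finset.prod_mul_distrib] at hp
  rw [div_mul_eq_mul_div, eq_div_iff (mul_ne_zero (mul_ne_zero hσ h2n) h1), rectangularNumerator]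
  linear_combination (∏ j, x j) * hp + symplecticAlternant m x * he

theorem symplectic_denominator_eq {n : ℕ} {x : Fin n → F} (h0 : ∀ i, x i ≠ 0) :
    Matrix.det (Matrix.of fun i j : Fin n =>
      x j ^ ((n : ℤ) - (i : ℕ)) - x j ^ (-((n : ℤ) - (i : ℕ)))) * ∏ j, x j ^ n =
      symplecticAlternant 0 x := by
  rw [mul_comm, ← Matrix.det_mul_row]
  refine congrArg Matrix.det ?_
  ext i j
  have h1 : ((0 + n + 1 + (i.rev : ℕ) : ℕ) : ℤ) = n + ((n : ℤ) - (i : ℕ)) := by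
    rw [Fin.val_rev]
    omega
  have h2 : ((i : ℕ) : ℤ) = n + -((n : ℤ) - (i : ℕ)) := by omega
  simp only [Matrix.of_apply]
  rw [← zpow_natCast (x j) (0 + n + 1 + (i.rev : ℕ)), ← zpow_natCast (x j) (i : ℕ), h1,
    ← zpow_natCast (x j) n, mul_sub, ← zpow_add₀ (h0 j), ← zpow_add₀ (h0 j), ← h2]

theorem schurP_rectangle_eq_sum_spP {n : ℕ} (m : ℕ) {x : Fin n → F} (hx : Generic x) :
    schurP (symmetricVariables x) (fun j => if (j : ℕ) < n then (m : ℤ) else 0) =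
    ∑ lam ∈ Finset.univ.filter
        (fun lam : Fin n → Fin (m + 1) => Antitone fun i => (lam i : ℕ)),
      spP x (fun i => ((lam i : ℕ) : ℤ)) := by
  have hden : Matrix.det (Matrix.of fun i j : Fin (2 * n + 1) => symmetricVariables x j ^
      (((2 * n + 1 : ℕ) : ℤ) - 1 - (i : ℕ))) = rectangularNumerator 0 x := by
    simp [rectangularNumerator]
  obtain ⟨c, hc, hnum⟩ := exists_rectangularNumerator_eq hx
  have hm := hnum m
  have h0 := hnum 0
  have hodd := oddAlternant_one_ne_zero hx
  have hsum := sum_symplectic_numerator m hx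
  have hsp := symplectic_denominator_eq hx.2.1
  have hxm : ∏ j, x j ^ m ≠ 0 := Finset.prod_ne_zero_iff.2 fun j _ => pow_ne_zero _ (hx.2.1 j)
  have hxn : ∏ j, x j ^ n ≠ 0 := Finset.prod_ne_zero_iff.2 fun j _ => pow_ne_zero _ (hx.2.1 j)
  simp only [pow_zero, Finset.prod_const_one, mul_one, zero_add] at h0
  simp only [pow_add, Finset.prod_mul_distrib] at hsum
  simp only [spP]
  rw [← Finset.sum_div, schurP, hden, h0, ← hsp]
  change rectangularNumerator m x / _ = _
  generalize rectangularNumerator m x = N at *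
  generalize Matrix.det (Matrix.of fun i j : Fin n =>
      x j ^ ((n : ℤ) - (i : ℕ)) - x j ^ (-((n : ℤ) - (i : ℕ)))) = H at *
  rw [← hsum] at hm
  by_cases hH : H = 0
  · simp [hH]
  · rw [div_eq_div_iff (mul_ne_zero hc (mul_ne_zero (mul_ne_zero hH hxn) hodd)) hH]
    refine mul_right_cancel₀ hxm ?_
    linear_combination H * hm

/-- **Corollary.**  For `n ≥ 1` and a nonnegative integer `m`, the Schur function of rectangular
shape `(m^n)` in the `2n+1` variables `(x_1, x_1^{-1}, …, x_n, x_n^{-1}, 1)` equals the sum of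
the symplectic characters `sp_λ(x_1,…,x_n)` over all partitions `λ ⊆ (m^n)`, as an identity in
`ℚ(x_1, …, x_n)`.  Here `gen n i` plays the role of `x_i`. -/
theorem schur_rectangle_eq_sum_sp (n m : ℕ) (hn : 1 ≤ n) :
    schurP
      (fun j : Fin (2 * n + 1) =>
        if h : (j : ℕ) = 2 * n then (1 : FF n)
        else if (j : ℕ) % 2 = 0 then gen n ⟨(j : ℕ) / 2, by have := j.isLt; omega⟩
        else (gen n ⟨(j : ℕ) / 2, by have := j.isLt; omega⟩)⁻¹)
      (fun j => if (j : ℕ) < n then (m : ℤ) else 0) =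
    ∑ lam ∈ Finset.univ.filter
        (fun lam : Fin n → Fin (m + 1) => Antitone fun i => (lam i : ℕ)),
      spP (gen n) (fun i => ((lam i : ℕ) : ℤ)) := by
  rw [← schurP_rectangle_eq_sum_spP m (Generic.gen n)]
  refine congrArg (fun z => schurP z _) (funext fun j => ?_)
  obtain ⟨b, rfl⟩ := (pairedColumns n).surjective j
  rw [symmetricVariables, Equiv.symm_apply_apply]
  rcases b with j | k
  · have hj : 2 * (j : ℕ) ≠ 2 * n := by omega
    simp [pairedColumns, hj]
  · induction k using Fin.lastCases with
    | last => simp [pairedColumns]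
    | cast j =>
      have h1 : (j : ℕ) ≠ n := by omega
      have h2 : 2 * (j : ℕ) + 1 ≠ 2 * n := by omega
      have h3 : (2 * (j : ℕ) + 1) / 2 = j := by omega
      simp [pairedColumns, h1, h2, h3, Nat.add_mod]
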